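/- arXiv:2404.18237 — 12 statements merged into one kernel-verified Lean document; each statement's English description precedes it below -/
import Mathlib

section
/- Let n be a positive integer coprime to 6. Then the maximal size of a conflict-free set of cells in (ZMod n)² is exactly n: there exists a conflict-free set of n cells, and every conflict-free set of cells has at most n elements. -/
/-- Two cells of the toroidal board `(ZMod n)²` are in conflict as toroidal queens
if they share a row, a column, or one of the two kinds of (toroidal) diagonals. -/
def Conflict {n : ℕ} (p q : ZMod n × ZMod n) : Prop :=
  p.1 = q.1 ∨ p.2 = q.2 ∨ p.1 + p.2 = q.1 + q.2 ∨ p.1 - p.2 = q.1 - q.2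

/-- A set of cells is conflict-free if no two distinct cells of it are in conflict. -/
def ConflictFree {n : ℕ} (S : Set (ZMod n × ZMod n)) : Prop :=
  ∀ p ∈ S, ∀ q ∈ S, p ≠ q → ¬ Conflict p q

theorem maximal_queens_coprime_six (n : ℕ) (hn : 0 < n) (h6 : Nat.Coprime n 6) :
    (∃ S : Set (ZMod n × ZMod n), ConflictFree S ∧ S.ncard = n) ∧
    (∀ S : Set (ZMod n × ZMod n), ConflictFree S → S.ncard ≤ n) := by
  haveI : NeZero n := ⟨hn.ne'⟩
  have u2 : IsUnit (2 : ZMod n) := by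
    have h : Nat.Coprime 2 n := (Nat.Coprime.coprime_dvd_right (by norm_num) h6).symm
    exact_mod_cast (ZMod.isUnit_iff_coprime 2 n).2 h
  have u3 : IsUnit (3 : ZMod n) := by
    have h : Nat.Coprime 3 n := (Nat.Coprime.coprime_dvd_right (by norm_num) h6).symm
    exact_mod_cast (ZMod.isUnit_iff_coprime 3 n).2 h
  refine ⟨⟨Set.range (fun x : ZMod n => (x, 2 * x)), ?_, ?_⟩, ?_⟩
  · rintro _ ⟨x, rfl⟩ _ ⟨y, rfl⟩ hne hc
    apply hne
    have hxy : x = y := by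
      rcases hc with h | h | h | h
      · exact h
      · exact u2.mul_left_cancel h
      · apply u3.mul_left_cancel
        simp only at h
        linear_combination h
      · simp only at h
        linear_combination -h
    rw [hxy]
  · rw [← Set.image_univ, Set.ncard_image_of_injective _ (fun x y h => congrArg Prod.fst h),
      Set.ncard_univ, Nat.card_zmod]
  · intro S hS
    have hinj : Set.InjOn Prod.fst S := by
      intro p hp q hq h
      by_contra hne
      exact hS p hp q hq hne (Or.inl h)
    calc S.ncard = (Prod.fst '' S).ncard := (Set.ncard_image_of_injOn hinj).symm
      _ ≤ (Set.univ : Set (ZMod n)).ncard := Set.ncard_le_ncard (Set.subset_univ _)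
      _ = n := by rw [Set.ncard_univ, Nat.card_zmod]
end

section
/- Let n be a positive integer coprime to 6. Then the set {(t, 2t) : t ∈ ZMod n} ⊆ (ZMod n)² has exactly n elements and is conflict-free. -/
theorem diag_construction_coprime_six (n : ℕ) (hn : 0 < n) (h6 : Nat.Coprime n 6) :
    ({p : ZMod n × ZMod n | ∃ t : ZMod n, p = (t, 2 * t)}.ncard = n) ∧
    ConflictFree {p : ZMod n × ZMod n | ∃ t : ZMod n, p = (t, 2 * t)} := by
  have h2 : IsUnit (2 : ZMod n) := by
    have := (ZMod.isUnit_iff_coprime 2 n).2 (Nat.Coprime.coprime_dvd_right (by norm_num) h6).symm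
    simpa using this
  have h3 : IsUnit (3 : ZMod n) := by
    have := (ZMod.isUnit_iff_coprime 3 n).2 (Nat.Coprime.coprime_dvd_right (by norm_num) h6).symm
    simpa using this
  constructor
  · have hS : {p : ZMod n × ZMod n | ∃ t : ZMod n, p = (t, 2 * t)}
        = (fun t : ZMod n => (t, 2 * t)) '' Set.univ := by
      ext p
      simp [eq_comm]
    rw [hS, Set.ncard_image_of_injective _ (fun a b h => (Prod.ext_iff.1 h).1), Set.ncard_univ,
      Nat.card_zmod]
  · rintro p ⟨s, rfl⟩ q ⟨t, rfl⟩ hne hc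
    apply hne
    have hst : s = t := by
      rcases hc with h | h | h | h
      · exact h
      · exact h2.mul_left_cancel h
      · apply h3.mul_left_cancel
        simp only at h
        linear_combination h
      · simp only at h
        linear_combination -h
    rw [hst]
end

section
/- Let n be a positive integer with n ≡ 2 (mod 12) or n ≡ 10 (mod 12) (equivalently n ≡ ±2 mod 12). Then there exists a conflict-free set of exactly n − 1 cells in (ZMod n)². -/
namespace QueensAux

/-- The half system `{1, …, (m-1)/2}` in `ZMod m`. -/
def H {m : ℕ} (x : ZMod m) : Prop := x.val ≠ 0 ∧ 2 * x.val < m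

lemma H_zero {m : ℕ} : ¬ H (0 : ZMod m) := by
  simp [H]

lemma H_neg {m : ℕ} [NeZero m] (x : ZMod m) (h : H x) : ¬ H (-x) := by
  obtain ⟨h0, h1⟩ := h
  have hx : x ≠ 0 := fun h => h0 (by simp [h])
  rintro ⟨h2, h3⟩
  have : NeZero x := ⟨hx⟩
  rw [ZMod.val_neg_of_ne_zero] at h3
  have := ZMod.val_lt x
  omega

lemma H_total {m : ℕ} [NeZero m] (hm : m % 2 = 1) (x : ZMod m) (h : ¬ H x) (hx : x ≠ 0) :
    H (-x) := by
  have h0 : x.val ≠ 0 := fun h => hx ((ZMod.val_eq_zero x).1 h)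
  have : NeZero x := ⟨hx⟩
  have := ZMod.val_lt x
  unfold H at h ⊢
  rw [ZMod.val_neg_of_ne_zero]
  omega

open Classical in
/-- Row class mod 2. -/
noncomputable def d {m : ℕ} (x : ZMod m) : ZMod 2 := if H x then 0 else 1

/-- The row of the queen in column `p`, in coordinates `ZMod 2 × ZMod m`. -/
noncomputable def f {m : ℕ} (p : ZMod 2 × ZMod m) : ZMod 2 × ZMod m :=
  (d p.2, if p.1 = d p.2 then 2 * p.2 else - (2 * p.2))

lemma cancel {m k : ℕ} (hk : Nat.Coprime k m) (a : ZMod m) (h : (k : ZMod m) * a = 0) : a = 0 := by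
  have hu : IsUnit (k : ZMod m) := (ZMod.isUnit_iff_coprime k m).2 hk
  exact (hu.mul_right_eq_zero).1 h

lemma core {m : ℕ} [NeZero m] (hm : m % 2 = 1) (h3m : m % 3 ≠ 0)
    (p q : ZMod 2 × ZMod m) (hp : p ≠ 0) (hq : q ≠ 0)
    (h : f p = f q ∨ p + f p = q + f q ∨ p - f p = q - f q) : p = q := by
  have c2 : Nat.Coprime 2 m := by
    rw [Nat.Prime.coprime_iff_not_dvd Nat.prime_two]; omega
  have c3 : Nat.Coprime 3 m := by
    rw [Nat.Prime.coprime_iff_not_dvd Nat.prime_three]; omega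
  obtain ⟨e, x⟩ := p
  obtain ⟨e', y⟩ := q
  have a1 : 2 * (x - y) = 0 → x - y = 0 := fun h => cancel c2 _ (by exact_mod_cast h)
  have a2 : 2 * (x + y) = 0 → x + y = 0 := fun h => cancel c2 _ (by exact_mod_cast h)
  have a3 : 3 * (x - y) = 0 → x - y = 0 := fun h => cancel c3 _ (by exact_mod_cast h)
  have a4 : 3 * (x + y) = 0 → x + y = 0 := fun h => cancel c3 _ (by exact_mod_cast h)
  have b0 := H_zero (m := m)
  have b1 := H_neg x
  have b2 := H_neg y
  have b3 := H_total hm x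
  have b4 := H_total hm y
  have b5 : x + y = 0 → y = -x := fun h => by linear_combination h
  have b6 : x + y = 0 → x = -y := fun h => by linear_combination h
  have n01 : (0 : ZMod 2) ≠ 1 := by decide
  have e11 : (1 : ZMod 2) + 1 = 0 := by decide
  have E : ∀ e : ZMod 2, e = 0 ∨ e = 1 := by decide
  simp only [f, d, Prod.mk.injEq, ne_eq, Prod.mk_eq_zero, Prod.mk_add_mk, Prod.mk_sub_mk] at *
  rcases E e with rfl | rfl <;> rcases E e' with rfl | rfl <;> by_cases hx : H x <;>
    by_cases hy : H y <;> simp [hx, hy] at h hp hq ⊢ <;> grind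

end QueensAux

open QueensAux in
theorem queens_two_mod_twelve (n : ℕ) (hn : 0 < n)
    (h : n % 12 = 2 ∨ n % 12 = 10) :
    ∃ S : Set (ZMod n × ZMod n), ConflictFree S ∧ S.ncard = n - 1 := by
  obtain ⟨m, rfl⟩ : ∃ m, n = 2 * m := ⟨n / 2, by omega⟩
  have hm : m % 2 = 1 := by omega
  have h3m : m % 3 ≠ 0 := by omega
  have : NeZero m := ⟨by omega⟩
  have : NeZero (2 * m) := ⟨by omega⟩
  have c2 : Nat.Coprime 2 m := by
    rw [Nat.Prime.coprime_iff_not_dvd Nat.prime_two]; omega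
  let e := ZMod.chineseRemainder c2
  let g : ZMod (2 * m) → ZMod (2 * m) × ZMod (2 * m) := fun a => (a, e.symm (f (e a)))
  have hg : Function.Injective g := fun a b h => congrArg Prod.fst h
  refine ⟨g '' {0}ᶜ, ?_, ?_⟩
  · rintro _ ⟨a, ha, rfl⟩ _ ⟨b, hb, rfl⟩ hne hc
    have ha' : e a ≠ 0 := fun h => ha (by simpa using h)
    have hb' : e b ≠ 0 := fun h => hb (by simpa using h)
    have hab : a ≠ b := fun h => hne (by rw [h])
    rcases hc with hc | hc
    · exact hab hc
    · apply hab
      apply e.injective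
      apply core hm h3m _ _ ha' hb'
      rcases hc with hc | hc | hc
      · left; exact e.symm.injective hc
      · right; left; simpa [g] using congrArg e hc
      · right; right; simpa [g] using congrArg e hc
  · rw [Set.ncard_image_of_injective _ hg, Set.ncard_compl, Set.ncard_singleton, Nat.card_zmod]
end

section
/- Let n = 2m where m is an odd positive integer not divisible by 3 (so n ≡ ±2 mod 12). Then the set consisting of the cells (t, 3t) for integers 0 ≤ t ≤ m − 1 together with the cells (t − 1, 3t) for integers m + 1 ≤ t ≤ 2m − 1 (all coordinates reduced mod n) is a conflict-free set of exactly n − 1 cells in (ZMod n)². -/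
/-- The cell with parameter `t`. -/
def cell (m t : ℕ) : ZMod (2 * m) × ZMod (2 * m) :=
  if t < m then ((t : ZMod (2 * m)), 3 * (t : ZMod (2 * m)))
  else ((t : ZMod (2 * m)) - 1, 3 * (t : ZMod (2 * m)))

lemma dvd_of_zmod_eq (m : ℕ) (a b : ℤ) (h : (a : ZMod (2 * m)) = (b : ZMod (2 * m))) :
    (2 * (m : ℤ)) ∣ a - b := by
  have := (ZMod.intCast_eq_intCast_iff_dvd_sub b a (2 * m)).1 h.symm
  simpa using this

lemma eq_of_dvd_small (N d : ℤ) (h : N ∣ d) (h1 : d < N) (h2 : -N < d) : d = 0 :=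
  Int.eq_zero_of_abs_lt_dvd h (abs_lt.2 ⟨h2, h1⟩)

/-- Arithmetic core: `e`, `f` are the shifts of the two cells. -/
lemma core (m : ℕ) (hodd : Odd m) (h3 : ¬ (3 ∣ m)) (t s e f : ℤ)
    (ht : (e = 0 ∧ 0 ≤ t ∧ t < m) ∨ (e = 1 ∧ m < t ∧ t < 2 * m))
    (hs : (f = 0 ∧ 0 ≤ s ∧ s < m) ∨ (f = 1 ∧ m < s ∧ s < 2 * m))
    (h : (2 * (m : ℤ)) ∣ (t - e) - (s - f) ∨ (2 * (m : ℤ)) ∣ 3 * t - 3 * s ∨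
      (2 * (m : ℤ)) ∣ (t - e + 3 * t) - (s - f + 3 * s) ∨
      (2 * (m : ℤ)) ∣ (t - e - 3 * t) - (s - f - 3 * s)) : t = s := by
  have c2 : IsCoprime (m : ℤ) 2 := by
    have : Nat.Coprime m 2 := Nat.coprime_two_right.2 hodd
    exact_mod_cast Nat.isCoprime_iff_coprime.2 this
  have c3 : IsCoprime (2 * (m : ℤ)) 3 := by
    have : Nat.Coprime (2 * m) 3 :=
      Nat.Coprime.mul_left (by norm_num) ((Nat.Prime.coprime_iff_not_dvd Nat.prime_three).2 h3).symm
    exact_mod_cast Nat.isCoprime_iff_coprime.2 this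
  have key : e = f → (m : ℤ) ∣ 2 * (t - s) → t = s := by
    intro hef hd
    have := eq_of_dvd_small _ _ (c2.dvd_of_dvd_mul_left hd) (by omega) (by omega)
    omega
  rcases h with h | h | h | h
  · have := eq_of_dvd_small _ _ h (by omega) (by omega)
    omega
  · rw [← mul_sub] at h
    have := eq_of_dvd_small _ _ (c3.dvd_of_dvd_mul_left h) (by omega) (by omega)
    omega
  · obtain ⟨k, hk⟩ := h
    rw [mul_assoc] at hk
    exact key (by omega) ⟨k, by omega⟩
  · obtain ⟨k, hk⟩ := h
    rw [mul_assoc] at hk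
    have hef : e = f := by omega
    exact key hef ⟨-2 * k, by linarith⟩

lemma cell_inj (m : ℕ) (hodd : Odd m) (h3 : ¬ (3 ∣ m)) (t s : ℕ)
    (ht : t < 2 * m ∧ t ≠ m) (hs : s < 2 * m ∧ s ≠ m)
    (h : Conflict (cell m t) (cell m s)) : t = s := by
  have hc : ∀ u : ℕ, u < 2 * m ∧ u ≠ m → ∃ e : ℤ,
      ((e = 0 ∧ 0 ≤ (u : ℤ) ∧ (u : ℤ) < m) ∨ (e = 1 ∧ (m : ℤ) < u ∧ (u : ℤ) < 2 * m)) ∧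
      cell m u = ((((u : ℤ) - e : ℤ) : ZMod (2 * m)), ((3 * (u : ℤ) : ℤ) : ZMod (2 * m))) := by
    intro u hu
    by_cases hlt : u < m
    · exact ⟨0, by omega, by simp [cell, hlt]⟩
    · exact ⟨1, by omega, by simp [cell, hlt]⟩
  obtain ⟨e, he, hte⟩ := hc t ht
  obtain ⟨f, hf, hsf⟩ := hc s hs
  rw [hte, hsf] at h
  have : (t : ℤ) = s := by
    refine core m hodd h3 t s e f he hf ?_
    simp only [Conflict, ← Int.cast_add, ← Int.cast_sub] at h
    exact h.imp (dvd_of_zmod_eq m _ _) (Or.imp (dvd_of_zmod_eq m _ _)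
      (Or.imp (dvd_of_zmod_eq m _ _) (dvd_of_zmod_eq m _ _)))
  exact_mod_cast this

theorem queens_construction_two_mod_twelve (m : ℕ) (hm : 0 < m) (hodd : Odd m)
    (h3 : ¬ (3 ∣ m)) :
    ConflictFree ({p : ZMod (2 * m) × ZMod (2 * m) |
        ∃ t : ℕ, t ≤ m - 1 ∧ p = ((t : ZMod (2 * m)), 3 * (t : ZMod (2 * m)))} ∪
      {p : ZMod (2 * m) × ZMod (2 * m) |
        ∃ t : ℕ, m + 1 ≤ t ∧ t ≤ 2 * m - 1 ∧
          p = ((t : ZMod (2 * m)) - 1, 3 * (t : ZMod (2 * m)))}) ∧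
    ({p : ZMod (2 * m) × ZMod (2 * m) |
        ∃ t : ℕ, t ≤ m - 1 ∧ p = ((t : ZMod (2 * m)), 3 * (t : ZMod (2 * m)))} ∪
      {p : ZMod (2 * m) × ZMod (2 * m) |
        ∃ t : ℕ, m + 1 ≤ t ∧ t ≤ 2 * m - 1 ∧
          p = ((t : ZMod (2 * m)) - 1, 3 * (t : ZMod (2 * m)))}).ncard = 2 * m - 1 := by
  have hS : ({p : ZMod (2 * m) × ZMod (2 * m) |
        ∃ t : ℕ, t ≤ m - 1 ∧ p = ((t : ZMod (2 * m)), 3 * (t : ZMod (2 * m)))} ∪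
      {p : ZMod (2 * m) × ZMod (2 * m) |
        ∃ t : ℕ, m + 1 ≤ t ∧ t ≤ 2 * m - 1 ∧
          p = ((t : ZMod (2 * m)) - 1, 3 * (t : ZMod (2 * m)))}) =
      cell m '' (((Finset.range (2 * m)).erase m : Finset ℕ) : Set ℕ) := by
    ext p
    simp only [Set.mem_union, Set.mem_setOf_eq, Set.mem_image, Finset.mem_coe, Finset.mem_erase,
      Finset.mem_range]
    constructor
    · rintro (⟨t, h1, rfl⟩ | ⟨t, h1, h2, rfl⟩)
      · exact ⟨t, by omega, by rw [cell, if_pos (by omega)]⟩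
      · exact ⟨t, by omega, by rw [cell, if_neg (by omega)]⟩
    · rintro ⟨t, h1, rfl⟩
      by_cases hlt : t < m
      · exact Or.inl ⟨t, by omega, by rw [cell, if_pos hlt]⟩
      · exact Or.inr ⟨t, by omega, by omega, by rw [cell, if_neg hlt]⟩
  have hmem : ∀ t ∈ (((Finset.range (2 * m)).erase m : Finset ℕ) : Set ℕ), t < 2 * m ∧ t ≠ m := by
    intro t ht
    simp only [Finset.mem_coe, Finset.mem_erase, Finset.mem_range] at ht
    exact ht.symm
  rw [hS]
  constructor
  · rintro p ⟨t, ht, rfl⟩ q ⟨s, hs, rfl⟩ hne hconf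
    exact hne (congrArg _ (cell_inj m hodd h3 t s (hmem t ht) (hmem s hs) hconf))
  · rw [Set.ncard_image_of_injOn, Set.ncard_coe_finset, Finset.card_erase_of_mem, Finset.card_range]
    · exact Finset.mem_range.2 (by omega)
    · intro t ht s hs h
      exact cell_inj m hodd h3 t s (hmem t ht) (hmem s hs) (Or.inl (congrArg Prod.fst h))
end

section
/- Let n be an odd positive integer divisible by 3. Then there exists a conflict-free set of exactly n − 2 cells in (ZMod n)². -/
/-- The offset of the piecewise linear construction `y = 2 x - e`. -/
def queenOffset (k x : ℕ) : ℤ :=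
  if x < 2 * k then 0 else if x < 3 * k + 1 then 1 else if x < 5 * k + 2 then 2 else 1

theorem queenOffset_spec (k x : ℕ) :
    (x < 2 * k ∧ queenOffset k x = 0) ∨ (2 * k ≤ x ∧ x < 3 * k + 1 ∧ queenOffset k x = 1) ∨
    (3 * k + 1 ≤ x ∧ x < 5 * k + 2 ∧ queenOffset k x = 2) ∨
    (5 * k + 2 ≤ x ∧ queenOffset k x = 1) := by
  unfold queenOffset
  split_ifs <;> omega

set_option maxHeartbeats 4000000 in
/-- If one of the four line indices agrees, so do the columns. -/
theorem queen_key (k x z : ℕ) (hx : x < 6 * k + 3) (hz : z < 6 * k + 3)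
    (hx1 : x ≠ 2 * k) (hx2 : x ≠ 3 * k + 1) (hz1 : z ≠ 2 * k) (hz2 : z ≠ 3 * k + 1)
    (c d : ℤ) (hcd : (c = 1 ∧ d = 0) ∨ (c = 2 ∧ d = 1) ∨ (c = 3 ∧ d = 1) ∨ (c = -1 ∧ d = -1))
    (h : ((6 * k + 3 : ℕ) : ℤ) ∣
      (c * x - d * queenOffset k x) - (c * z - d * queenOffset k z)) : x = z := by
  obtain ⟨q, hq⟩ := h
  have h1 := queenOffset_spec k x
  have h2 := queenOffset_spec k z
  generalize queenOffset k x = e at *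
  generalize queenOffset k z = f at *
  have hk : (0 : ℤ) ≤ k := by positivity
  push_cast at hq
  have hb1 : (6 * (k : ℤ) + 3) * q < (6 * (k : ℤ) + 3) * 4 := by
    rw [← hq]
    rcases hcd with ⟨rfl, rfl⟩ | ⟨rfl, rfl⟩ | ⟨rfl, rfl⟩ | ⟨rfl, rfl⟩ <;> omega
  have hb2 : (6 * (k : ℤ) + 3) * (-4) < (6 * (k : ℤ) + 3) * q := by
    rw [← hq]
    rcases hcd with ⟨rfl, rfl⟩ | ⟨rfl, rfl⟩ | ⟨rfl, rfl⟩ | ⟨rfl, rfl⟩ <;> omega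
  have hq1 : q < 4 := lt_of_mul_lt_mul_left hb1 (by omega)
  have hq2 : -4 < q := lt_of_mul_lt_mul_left hb2 (by omega)
  clear hb1 hb2
  rcases hcd with ⟨rfl, rfl⟩ | ⟨rfl, rfl⟩ | ⟨rfl, rfl⟩ | ⟨rfl, rfl⟩ <;>
  interval_cases q <;>
  rcases h1 with h1 | h1 | h1 | h1 <;> rcases h2 with h2 | h2 | h2 | h2 <;> omega

theorem queens_odd_multiple_of_three (n : ℕ) (hn : 0 < n) (hodd : Odd n)
    (h3 : 3 ∣ n) :
    ∃ S : Set (ZMod n × ZMod n), ConflictFree S ∧ S.ncard = n - 2 := by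
  obtain ⟨k, rfl⟩ : ∃ k, n = 6 * k + 3 := by
    obtain ⟨a, ha⟩ := hodd
    exact ⟨n / 6, by omega⟩
  set T : Finset ℕ := ((Finset.range (6 * k + 3)).erase (2 * k)).erase (3 * k + 1) with hT
  set F : ℕ → ZMod (6 * k + 3) × ZMod (6 * k + 3) :=
    fun x => (((x : ℤ) : ZMod (6 * k + 3)), ((2 * x - queenOffset k x : ℤ) : ZMod (6 * k + 3)))
    with hF
  have key : ∀ x ∈ T, ∀ z ∈ T, Conflict (F x) (F z) → x = z := by
    intro x hx z hz hc
    simp only [hT, Finset.mem_erase, Finset.mem_range] at hx hz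
    have fin := queen_key k x z hx.2.2 hz.2.2 hx.2.1 hx.1 hz.2.1 hz.1
    simp only [Conflict, hF, ← Int.cast_add, ← Int.cast_sub] at hc
    rcases hc with hc | hc | hc | hc <;>
      have hd := (ZMod.intCast_eq_intCast_iff_dvd_sub _ _ _).1 hc.symm
    · exact fin 1 0 (by simp) (by convert hd using 1; ring)
    · exact fin 2 1 (by simp) (by convert hd using 1; ring)
    · exact fin 3 1 (by simp) (by convert hd using 1; ring)
    · exact fin (-1) (-1) (by simp) (by convert hd using 1; ring)
  refine ⟨F '' (T : Set ℕ), ?_, ?_⟩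
  · rintro _ ⟨x, hx, rfl⟩ _ ⟨z, hz, rfl⟩ hne hc
    exact hne (congrArg F (key x hx z hz hc))
  · rw [Set.InjOn.ncard_image, Set.ncard_coe_finset, hT, Finset.card_erase_of_mem,
      Finset.card_erase_of_mem, Finset.card_range]
    · omega
    · simp; omega
    · simp; omega
    · intro x hx z hz h
      exact key x hx z hz (Or.inl (congrArg Prod.fst h))
end

section
/- For every integer n ≥ 2 there exists a conflict-free set of exactly n − 2 cells in (ZMod n)². -/
/-- General construction: cells indexed by `0 ≤ i < n`, with two indices left out. -/
theorem build (n : ℕ) (N s t : ℤ) (hN : N = n) (hs : 0 ≤ s ∧ s < N) (ht : 0 ≤ t ∧ t < N) (hst : s ≠ t)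
    (P : ℤ → ℤ → ℤ → Prop)
    (hex : ∀ i : ℤ, 0 ≤ i → i < N → i ≠ s → i ≠ t → ∃ x y, P i x y)
    (hP : ∀ i i' x y x' y' d : ℤ, i < i' → P i x y → P i' x' y' →
      x - x' ≠ N * d ∧ y - y' ≠ N * d ∧ (x + y) - (x' + y') ≠ N * d ∧
        (x - y) - (x' - y') ≠ N * d) :
    ∃ S : Set (ZMod n × ZMod n), ConflictFree S ∧ S.ncard = n - 2 := by
  subst hN
  let I : Finset ℤ := ((Finset.Ico (0 : ℤ) n).erase s).erase t
  have hI : ∀ i ∈ I, ∃ x y, P i x y := by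
    intro i hi
    simp only [I, Finset.mem_erase, Finset.mem_Ico] at hi
    exact hex i hi.2.2.1 hi.2.2.2 hi.2.1 hi.1
  have hcard : I.card = n - 2 := by
    have h1 : s ∈ Finset.Ico (0 : ℤ) n := by simpa using hs
    have h2 : t ∈ (Finset.Ico (0 : ℤ) n).erase s := by
      simp only [Finset.mem_erase, Finset.mem_Ico]
      exact ⟨hst.symm, ht⟩
    rw [Finset.card_erase_of_mem h2, Finset.card_erase_of_mem h1]
    simp
    omega
  choose! X Y hXY using hI
  have key : ∀ a b : ℤ, (a : ZMod n) = (b : ZMod n) → ∃ d : ℤ, a - b = n * d := by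
    intro a b h
    have := (ZMod.intCast_eq_intCast_iff_dvd_sub b a n).1 h.symm
    exact this
  have main : ∀ i ∈ I, ∀ i' ∈ I, i < i' →
      ¬ Conflict (((X i : ℤ) : ZMod n), ((Y i : ℤ) : ZMod n))
        (((X i' : ℤ) : ZMod n), ((Y i' : ℤ) : ZMod n)) := by
    intro i hi i' hi' hlt hc
    have H := fun d => hP i i' _ _ _ _ d hlt (hXY i hi) (hXY i' hi')
    rcases hc with h | h | h | h
    · obtain ⟨d, hd⟩ := key _ _ h
      exact (H d).1 hd
    · obtain ⟨d, hd⟩ := key _ _ h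
      exact (H d).2.1 hd
    · obtain ⟨d, hd⟩ := key (X i + Y i) (X i' + Y i') (by push_cast; exact h)
      exact (H d).2.2.1 hd
    · obtain ⟨d, hd⟩ := key (X i - Y i) (X i' - Y i') (by push_cast; exact h)
      exact (H d).2.2.2 hd
  have hsymm : ∀ p q : ZMod n × ZMod n, Conflict p q → Conflict q p := by
    intro p q h
    rcases h with h | h | h | h
    · exact Or.inl h.symm
    · exact Or.inr (Or.inl h.symm)
    · exact Or.inr (Or.inr (Or.inl h.symm))
    · exact Or.inr (Or.inr (Or.inr h.symm))
  let f : ℤ → ZMod n × ZMod n := fun i => (((X i : ℤ) : ZMod n), ((Y i : ℤ) : ZMod n))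
  refine ⟨f '' (I : Set ℤ), ?_, ?_⟩
  · rintro p ⟨i, hi, rfl⟩ q ⟨i', hi', rfl⟩ hne hc
    rcases lt_trichotomy i i' with h | h | h
    · exact main i hi i' hi' h hc
    · exact hne (by rw [h])
    · exact main i' hi' i hi h (hsymm _ _ hc)
  · rw [Set.ncard_image_of_injOn, Set.ncard_coe_finset, hcard]
    intro i hi i' hi' he
    rcases lt_trichotomy i i' with h | h | h
    · exact absurd (Or.inl (congrArg Prod.fst he)) (main i hi i' hi' h)
    · exact h
    · exact absurd (Or.inl (congrArg Prod.fst he).symm) (main i' hi' i hi h)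

theorem quot_bound {N d e : ℤ} (B : ℤ) (hN : 0 < N) (he : e = N * d) (h1 : e < N * B)
    (h2 : N * (-B) < e) : -B < d ∧ d < B := by
  rw [he] at h1 h2
  exact ⟨lt_of_mul_lt_mul_left h2 hN.le, lt_of_mul_lt_mul_left h1 hN.le⟩

/-- Cells of family A. -/
inductive CellA (m : ℤ) : ℤ → ℤ → ℤ → Prop
  | p0 (i : ℤ) (h0 : 0 ≤ i) (h1 : i < m-2) : CellA m i (i) (2*i)

theorem boundsA (m : ℤ) (h2 : m % 2 = 1) (h3 : m % 3 ≠ 0) (hp : 2 ≤ m) {i x y : ℤ} (h : CellA m i x y) :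
    ((m) * (0) ≤ x ∧ x < (m) * (1)) ∧ ((m) * (0) ≤ y ∧ y < (m) * (2)) ∧
    ((m) * (0) ≤ x + y ∧ x + y < (m) * (3)) ∧ ((m) * (-1) ≤ x - y ∧ x - y < (m) * (1)) := by
  cases h <;> omega

theorem existsA (m : ℤ) (h2 : m % 2 = 1) (h3 : m % 3 ≠ 0) (hp : 2 ≤ m) (i : ℤ) (hi0 : 0 ≤ i) (hi1 : i < m)
    (hs : i ≠ m-2) (ht : i ≠ m-1) : ∃ x y, CellA m i x y := by
  exact ⟨_, _, CellA.p0 i (by omega) (by omega)⟩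

set_option maxHeartbeats 4000000 in
theorem sepA (m : ℤ) (h2 : m % 2 = 1) (h3 : m % 3 ≠ 0) (hp : 2 ≤ m) (i i' x y x' y' d : ℤ) (hlt : i < i')
    (h : CellA m i x y) (h' : CellA m i' x' y') :
    x - x' ≠ (m) * d ∧ y - y' ≠ (m) * d ∧ (x + y) - (x' + y') ≠ (m) * d ∧
      (x - y) - (x' - y') ≠ (m) * d := by
  have b := boundsA m h2 h3 hp h
  have b' := boundsA m h2 h3 hp h'
  refine ⟨fun he => ?_, fun he => ?_, fun he => ?_, fun he => ?_⟩
  on_goal 1 => have q := quot_bound 1 (by omega) he (by omega) (by omega)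
  on_goal 2 => have q := quot_bound 2 (by omega) he (by omega) (by omega)
  on_goal 3 => have q := quot_bound 3 (by omega) he (by omega) (by omega)
  on_goal 4 => have q := quot_bound 2 (by omega) he (by omega) (by omega)
  all_goals
    obtain ⟨hd1, hd2⟩ := q
    clear b b'
    cases h <;> cases h' <;> first
      | (exfalso; clear he hd1 hd2; omega)
      | (interval_cases d <;> omega)

theorem familyA (n : ℕ) (m : ℤ) (h2 : m % 2 = 1) (h3 : m % 3 ≠ 0) (hp : 2 ≤ m) (hn : m = (n : ℤ)) :
    ∃ S : Set (ZMod n × ZMod n), ConflictFree S ∧ S.ncard = n - 2 :=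
  build n (m) (m-2) (m-1) hn (by omega) (by omega) (by omega) (CellA m)
    (existsA m h2 h3 hp) (sepA m h2 h3 hp)

/-- Cells of family B. -/
inductive CellB (r : ℤ) : ℤ → ℤ → ℤ → Prop
  | p0 (i : ℤ) (h0 : 0 ≤ i) (h1 : i < 2*r+1) : CellB r i (i) (2*i)
  | p1 (i : ℤ) (h0 : 2*r+1 ≤ i) (h1 : i < 3*r+1) : CellB r i (i) (2*i+1)
  | p2 (i : ℤ) (h0 : 3*r+1 ≤ i) (h1 : i < 5*r+2) : CellB r i (i) (2*i+2)
  | p3 (i : ℤ) (h0 : 5*r+3 ≤ i) (h1 : i < 6*r+2) : CellB r i (i) (2*i+1)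

theorem boundsB (r : ℤ) (hp : 1 ≤ r) {i x y : ℤ} (h : CellB r i x y) :
    ((6*r+3) * (0) ≤ x ∧ x < (6*r+3) * (1)) ∧ ((6*r+3) * (0) ≤ y ∧ y < (6*r+3) * (2)) ∧
    ((6*r+3) * (0) ≤ x + y ∧ x + y < (6*r+3) * (3)) ∧ ((6*r+3) * (-1) ≤ x - y ∧ x - y < (6*r+3) * (1)) := by
  cases h <;> omega

theorem existsB (r : ℤ) (hp : 1 ≤ r) (i : ℤ) (hi0 : 0 ≤ i) (hi1 : i < 6*r+3)
    (hs : i ≠ 5*r+2) (ht : i ≠ 6*r+2) : ∃ x y, CellB r i x y := by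
  by_cases c0 : i < 2*r+1
  · exact ⟨_, _, CellB.p0 i (by omega) c0⟩
  by_cases c1 : i < 3*r+1
  · exact ⟨_, _, CellB.p1 i (by omega) c1⟩
  by_cases c2 : i < 5*r+2
  · exact ⟨_, _, CellB.p2 i (by omega) c2⟩
  exact ⟨_, _, CellB.p3 i (by omega) (by omega)⟩

set_option maxHeartbeats 4000000 in
theorem sepB (r : ℤ) (hp : 1 ≤ r) (i i' x y x' y' d : ℤ) (hlt : i < i')
    (h : CellB r i x y) (h' : CellB r i' x' y') :
    x - x' ≠ (6*r+3) * d ∧ y - y' ≠ (6*r+3) * d ∧ (x + y) - (x' + y') ≠ (6*r+3) * d ∧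
      (x - y) - (x' - y') ≠ (6*r+3) * d := by
  have b := boundsB r hp h
  have b' := boundsB r hp h'
  refine ⟨fun he => ?_, fun he => ?_, fun he => ?_, fun he => ?_⟩
  on_goal 1 => have q := quot_bound 1 (by omega) he (by omega) (by omega)
  on_goal 2 => have q := quot_bound 2 (by omega) he (by omega) (by omega)
  on_goal 3 => have q := quot_bound 3 (by omega) he (by omega) (by omega)
  on_goal 4 => have q := quot_bound 2 (by omega) he (by omega) (by omega)
  all_goals
    obtain ⟨hd1, hd2⟩ := q
    clear b b'
    cases h <;> cases h' <;> first
      | (exfalso; clear he hd1 hd2; omega)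
      | (interval_cases d <;> omega)

theorem familyB (n : ℕ) (r : ℤ) (hp : 1 ≤ r) (hn : 6*r+3 = (n : ℤ)) :
    ∃ S : Set (ZMod n × ZMod n), ConflictFree S ∧ S.ncard = n - 2 :=
  build n (6*r+3) (5*r+2) (6*r+2) hn (by omega) (by omega) (by omega) (CellB r)
    (existsB r hp) (sepB r hp)

/-- Cells of family Ca. -/
inductive CellCa (k : ℤ) : ℤ → ℤ → ℤ → Prop
  | p0 (i : ℤ) (h0 : 0 ≤ i) (h1 : i < k-1) : CellCa k i (i) (2*i)
  | p1 (i : ℤ) (h0 : k-1 ≤ i) (h1 : i < k) : CellCa k i (i) (8*k-1)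
  | p2 (i : ℤ) (h0 : k ≤ i) (h1 : i < 4*k-1) : CellCa k i (i) (2*i)
  | p3 (i : ℤ) (h0 : 4*k-1 ≤ i) (h1 : i < 6*k-1) : CellCa k i (i) (2*i+2)
  | p4 (i : ℤ) (h0 : 6*k ≤ i) (h1 : i < 7*k-1) : CellCa k i (i) (2*i+1)
  | p5 (i : ℤ) (h0 : 7*k-1 ≤ i) (h1 : i < 7*k) : CellCa k i (i) (8*k-2)
  | p6 (i : ℤ) (h0 : 7*k ≤ i) (h1 : i < 10*k-1) : CellCa k i (i) (2*i+1)
  | p7 (i : ℤ) (h0 : 10*k-1 ≤ i) (h1 : i < 10*k) : CellCa k i (i) (2*k-2)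
  | p8 (i : ℤ) (h0 : 10*k+1 ≤ i) (h1 : i < 12*k) : CellCa k i (i) (2*i-1)

theorem boundsCa (k : ℤ) (hp : 1 ≤ k) {i x y : ℤ} (h : CellCa k i x y) :
    ((12*k) * (0) ≤ x ∧ x < (12*k) * (1)) ∧ ((12*k) * (0) ≤ y ∧ y < (12*k) * (2)) ∧
    ((12*k) * (0) ≤ x + y ∧ x + y < (12*k) * (3)) ∧ ((12*k) * (-1) ≤ x - y ∧ x - y < (12*k) * (1)) := by
  cases h <;> omega

theorem existsCa (k : ℤ) (hp : 1 ≤ k) (i : ℤ) (hi0 : 0 ≤ i) (hi1 : i < 12*k)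
    (hs : i ≠ 6*k-1) (ht : i ≠ 10*k) : ∃ x y, CellCa k i x y := by
  by_cases c0 : i < k-1
  · exact ⟨_, _, CellCa.p0 i (by omega) c0⟩
  by_cases c1 : i < k
  · exact ⟨_, _, CellCa.p1 i (by omega) c1⟩
  by_cases c2 : i < 4*k-1
  · exact ⟨_, _, CellCa.p2 i (by omega) c2⟩
  by_cases c3 : i < 6*k-1
  · exact ⟨_, _, CellCa.p3 i (by omega) c3⟩
  by_cases c4 : i < 7*k-1
  · exact ⟨_, _, CellCa.p4 i (by omega) c4⟩
  by_cases c5 : i < 7*k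
  · exact ⟨_, _, CellCa.p5 i (by omega) c5⟩
  by_cases c6 : i < 10*k-1
  · exact ⟨_, _, CellCa.p6 i (by omega) c6⟩
  by_cases c7 : i < 10*k
  · exact ⟨_, _, CellCa.p7 i (by omega) c7⟩
  exact ⟨_, _, CellCa.p8 i (by omega) (by omega)⟩

set_option maxHeartbeats 4000000 in
theorem sepCa (k : ℤ) (hp : 1 ≤ k) (i i' x y x' y' d : ℤ) (hlt : i < i')
    (h : CellCa k i x y) (h' : CellCa k i' x' y') :
    x - x' ≠ (12*k) * d ∧ y - y' ≠ (12*k) * d ∧ (x + y) - (x' + y') ≠ (12*k) * d ∧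
      (x - y) - (x' - y') ≠ (12*k) * d := by
  have b := boundsCa k hp h
  have b' := boundsCa k hp h'
  refine ⟨fun he => ?_, fun he => ?_, fun he => ?_, fun he => ?_⟩
  on_goal 1 => have q := quot_bound 1 (by omega) he (by omega) (by omega)
  on_goal 2 => have q := quot_bound 2 (by omega) he (by omega) (by omega)
  on_goal 3 => have q := quot_bound 3 (by omega) he (by omega) (by omega)
  on_goal 4 => have q := quot_bound 2 (by omega) he (by omega) (by omega)
  all_goals
    obtain ⟨hd1, hd2⟩ := q
    clear b b'
    cases h <;> cases h' <;> first
      | (exfalso; clear he hd1 hd2; omega)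
      | (interval_cases d <;> omega)

theorem familyCa (n : ℕ) (k : ℤ) (hp : 1 ≤ k) (hn : 12*k = (n : ℤ)) :
    ∃ S : Set (ZMod n × ZMod n), ConflictFree S ∧ S.ncard = n - 2 :=
  build n (12*k) (6*k-1) (10*k) hn (by omega) (by omega) (by omega) (CellCa k)
    (existsCa k hp) (sepCa k hp)

/-- Cells of family Cb. -/
inductive CellCb (k : ℤ) : ℤ → ℤ → ℤ → Prop
  | p0 (i : ℤ) (h0 : 0 ≤ i) (h1 : i < k) : CellCb k i (i) (2*i)
  | p1 (i : ℤ) (h0 : k ≤ i) (h1 : i < k+1) : CellCb k i (i) (8*k+4)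
  | p2 (i : ℤ) (h0 : k+1 ≤ i) (h1 : i < 4*k+2) : CellCb k i (i) (2*i)
  | p3 (i : ℤ) (h0 : 4*k+2 ≤ i) (h1 : i < 6*k+2) : CellCb k i (i) (2*i+2)
  | p4 (i : ℤ) (h0 : 6*k+3 ≤ i) (h1 : i < 7*k+3) : CellCb k i (i) (2*i+1)
  | p5 (i : ℤ) (h0 : 7*k+3 ≤ i) (h1 : i < 7*k+4) : CellCb k i (i) (8*k+3)
  | p6 (i : ℤ) (h0 : 7*k+4 ≤ i) (h1 : i < 10*k+4) : CellCb k i (i) (2*i+1)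
  | p7 (i : ℤ) (h0 : 10*k+4 ≤ i) (h1 : i < 10*k+5) : CellCb k i (i) (2*k+1)
  | p8 (i : ℤ) (h0 : 10*k+6 ≤ i) (h1 : i < 12*k+6) : CellCb k i (i) (2*i-1)

theorem boundsCb (k : ℤ) (hp : 0 ≤ k) {i x y : ℤ} (h : CellCb k i x y) :
    ((12*k+6) * (0) ≤ x ∧ x < (12*k+6) * (1)) ∧ ((12*k+6) * (0) ≤ y ∧ y < (12*k+6) * (2)) ∧
    ((12*k+6) * (0) ≤ x + y ∧ x + y < (12*k+6) * (3)) ∧ ((12*k+6) * (-1) ≤ x - y ∧ x - y < (12*k+6) * (1)) := by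
  cases h <;> omega

theorem existsCb (k : ℤ) (hp : 0 ≤ k) (i : ℤ) (hi0 : 0 ≤ i) (hi1 : i < 12*k+6)
    (hs : i ≠ 6*k+2) (ht : i ≠ 10*k+5) : ∃ x y, CellCb k i x y := by
  by_cases c0 : i < k
  · exact ⟨_, _, CellCb.p0 i (by omega) c0⟩
  by_cases c1 : i < k+1
  · exact ⟨_, _, CellCb.p1 i (by omega) c1⟩
  by_cases c2 : i < 4*k+2
  · exact ⟨_, _, CellCb.p2 i (by omega) c2⟩
  by_cases c3 : i < 6*k+2
  · exact ⟨_, _, CellCb.p3 i (by omega) c3⟩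
  by_cases c4 : i < 7*k+3
  · exact ⟨_, _, CellCb.p4 i (by omega) c4⟩
  by_cases c5 : i < 7*k+4
  · exact ⟨_, _, CellCb.p5 i (by omega) c5⟩
  by_cases c6 : i < 10*k+4
  · exact ⟨_, _, CellCb.p6 i (by omega) c6⟩
  by_cases c7 : i < 10*k+5
  · exact ⟨_, _, CellCb.p7 i (by omega) c7⟩
  exact ⟨_, _, CellCb.p8 i (by omega) (by omega)⟩

set_option maxHeartbeats 4000000 in
theorem sepCb (k : ℤ) (hp : 0 ≤ k) (i i' x y x' y' d : ℤ) (hlt : i < i')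
    (h : CellCb k i x y) (h' : CellCb k i' x' y') :
    x - x' ≠ (12*k+6) * d ∧ y - y' ≠ (12*k+6) * d ∧ (x + y) - (x' + y') ≠ (12*k+6) * d ∧
      (x - y) - (x' - y') ≠ (12*k+6) * d := by
  have b := boundsCb k hp h
  have b' := boundsCb k hp h'
  refine ⟨fun he => ?_, fun he => ?_, fun he => ?_, fun he => ?_⟩
  on_goal 1 => have q := quot_bound 1 (by omega) he (by omega) (by omega)
  on_goal 2 => have q := quot_bound 2 (by omega) he (by omega) (by omega)
  on_goal 3 => have q := quot_bound 3 (by omega) he (by omega) (by omega)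
  on_goal 4 => have q := quot_bound 2 (by omega) he (by omega) (by omega)
  all_goals
    obtain ⟨hd1, hd2⟩ := q
    clear b b'
    cases h <;> cases h' <;> first
      | (exfalso; clear he hd1 hd2; omega)
      | (interval_cases d <;> omega)

theorem familyCb (n : ℕ) (k : ℤ) (hp : 0 ≤ k) (hn : 12*k+6 = (n : ℤ)) :
    ∃ S : Set (ZMod n × ZMod n), ConflictFree S ∧ S.ncard = n - 2 :=
  build n (12*k+6) (6*k+2) (10*k+5) hn (by omega) (by omega) (by omega) (CellCb k)
    (existsCb k hp) (sepCb k hp)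

/-- Cells of family D. -/
inductive CellD (r : ℤ) : ℤ → ℤ → ℤ → Prop
  | p0 (i : ℤ) (h0 : 0*r ≤ i) (h1 : i < 1*r) : CellD r i (2*(i-0*r)+(0)) (4*(i-0*r)+(0))
  | p1 (i : ℤ) (h0 : 1*r ≤ i) (h1 : i < 2*r) : CellD r i (2*(i-1*r)+(1+(2*r+1))) (4*(i-1*r)+(4+(2*r+1)))
  | p2 (i : ℤ) (h0 : 2*r ≤ i) (h1 : i < 3*r) : CellD r i (2*(i-2*r)+((2*r+1))) (4*(i-2*r)+(2))
  | p3 (i : ℤ) (h0 : 3*r ≤ i) (h1 : i < 4*r) : CellD r i (2*(i-3*r)+(1)) (4*(i-3*r)+(2+(2*r+1)))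

theorem boundsD (r : ℤ) (h3 : (2*r+1) % 3 ≠ 0) (hp : 0 ≤ r) {i x y : ℤ} (h : CellD r i x y) :
    ((4*r+2) * (0) ≤ x ∧ x < (4*r+2) * (1)) ∧ ((4*r+2) * (0) ≤ y ∧ y < (4*r+2) * (2)) ∧
    ((4*r+2) * (0) ≤ x + y ∧ x + y < (4*r+2) * (3)) ∧ ((4*r+2) * (-1) ≤ x - y ∧ x - y < (4*r+2) * (1)) := by
  cases h <;> omega

theorem existsD (r : ℤ) (h3 : (2*r+1) % 3 ≠ 0) (hp : 0 ≤ r) (i : ℤ) (hi0 : 0 ≤ i) (hi1 : i < 4*r+2)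
    (hs : i ≠ 4*r) (ht : i ≠ 4*r+1) : ∃ x y, CellD r i x y := by
  by_cases c0 : i < 1*r
  · exact ⟨_, _, CellD.p0 i (by omega) c0⟩
  by_cases c1 : i < 2*r
  · exact ⟨_, _, CellD.p1 i (by omega) c1⟩
  by_cases c2 : i < 3*r
  · exact ⟨_, _, CellD.p2 i (by omega) c2⟩
  exact ⟨_, _, CellD.p3 i (by omega) (by omega)⟩

set_option maxHeartbeats 4000000 in
theorem sepD (r : ℤ) (h3 : (2*r+1) % 3 ≠ 0) (hp : 0 ≤ r) (i i' x y x' y' d : ℤ) (hlt : i < i')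
    (h : CellD r i x y) (h' : CellD r i' x' y') :
    x - x' ≠ (4*r+2) * d ∧ y - y' ≠ (4*r+2) * d ∧ (x + y) - (x' + y') ≠ (4*r+2) * d ∧
      (x - y) - (x' - y') ≠ (4*r+2) * d := by
  have b := boundsD r h3 hp h
  have b' := boundsD r h3 hp h'
  refine ⟨fun he => ?_, fun he => ?_, fun he => ?_, fun he => ?_⟩
  on_goal 1 => have q := quot_bound 1 (by omega) he (by omega) (by omega)
  on_goal 2 => have q := quot_bound 2 (by omega) he (by omega) (by omega)
  on_goal 3 => have q := quot_bound 3 (by omega) he (by omega) (by omega)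
  on_goal 4 => have q := quot_bound 2 (by omega) he (by omega) (by omega)
  all_goals
    obtain ⟨hd1, hd2⟩ := q
    clear b b'
    cases h <;> cases h' <;> first
      | (exfalso; clear he hd1 hd2; omega)
      | (interval_cases d <;> omega)

theorem familyD (n : ℕ) (r : ℤ) (h3 : (2*r+1) % 3 ≠ 0) (hp : 0 ≤ r) (hn : 4*r+2 = (n : ℤ)) :
    ∃ S : Set (ZMod n × ZMod n), ConflictFree S ∧ S.ncard = n - 2 :=
  build n (4*r+2) (4*r) (4*r+1) hn (by omega) (by omega) (by omega) (CellD r)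
    (existsD r h3 hp) (sepD r h3 hp)

/-- Cells of family E. -/
inductive CellE (k : ℤ) : ℤ → ℤ → ℤ → Prop
  | p0 (i : ℤ) (h0 : 0*(k-1) ≤ i) (h1 : i < 1*(k-1)) : CellE k i (2*(i-0*(k-1))+(0)) (4*(i-0*(k-1))+(0))
  | p1 (i : ℤ) (h0 : 1*(k-1) ≤ i) (h1 : i < 2*(k-1)) : CellE k i (2*(i-1*(k-1))+(1)) (4*(i-1*(k-1))+(2*k-1))
  | p2 (i : ℤ) (h0 : 2*(k-1) ≤ i) (h1 : i < 3*(k-1)) : CellE k i (2*(i-2*(k-1))+(2*k-1)) (4*(i-2*(k-1))+(2*k-4))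
  | p3 (i : ℤ) (h0 : 3*(k-1) ≤ i) (h1 : i < 4*(k-1)) : CellE k i (2*(i-3*(k-1))+(2*k+2)) (4*(i-3*(k-1))+(4*k-1))
  | p4 (i : ℤ) (h0 : 4*k-4 ≤ i) (h1 : i < 4*k-3) : CellE k i (4*k-3) (2*k-8)
  | p5 (i : ℤ) (h0 : 4*k-3 ≤ i) (h1 : i < 4*k-2) : CellE k i (4*k-1) (4*k-5)

theorem boundsE (k : ℤ) (h3 : k % 3 ≠ 0) (h2 : k % 2 = 1) (hp : 1 ≤ k) {i x y : ℤ} (h : CellE k i x y) :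
    ((4*k) * (0) ≤ x ∧ x < (4*k) * (1)) ∧ ((4*k) * (-2) ≤ y ∧ y < (4*k) * (2)) ∧
    ((4*k) * (-2) ≤ x + y ∧ x + y < (4*k) * (3)) ∧ ((4*k) * (-1) ≤ x - y ∧ x - y < (4*k) * (2)) := by
  cases h <;> omega

theorem existsE (k : ℤ) (h3 : k % 3 ≠ 0) (h2 : k % 2 = 1) (hp : 1 ≤ k) (i : ℤ) (hi0 : 0 ≤ i) (hi1 : i < 4*k)
    (hs : i ≠ 4*k-2) (ht : i ≠ 4*k-1) : ∃ x y, CellE k i x y := by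
  by_cases c0 : i < 1*(k-1)
  · exact ⟨_, _, CellE.p0 i (by omega) c0⟩
  by_cases c1 : i < 2*(k-1)
  · exact ⟨_, _, CellE.p1 i (by omega) c1⟩
  by_cases c2 : i < 3*(k-1)
  · exact ⟨_, _, CellE.p2 i (by omega) c2⟩
  by_cases c3 : i < 4*(k-1)
  · exact ⟨_, _, CellE.p3 i (by omega) c3⟩
  by_cases c4 : i < 4*k-3
  · exact ⟨_, _, CellE.p4 i (by omega) c4⟩
  exact ⟨_, _, CellE.p5 i (by omega) (by omega)⟩

set_option maxHeartbeats 4000000 in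
theorem sepE (k : ℤ) (h3 : k % 3 ≠ 0) (h2 : k % 2 = 1) (hp : 1 ≤ k) (i i' x y x' y' d : ℤ) (hlt : i < i')
    (h : CellE k i x y) (h' : CellE k i' x' y') :
    x - x' ≠ (4*k) * d ∧ y - y' ≠ (4*k) * d ∧ (x + y) - (x' + y') ≠ (4*k) * d ∧
      (x - y) - (x' - y') ≠ (4*k) * d := by
  have b := boundsE k h3 h2 hp h
  have b' := boundsE k h3 h2 hp h'
  refine ⟨fun he => ?_, fun he => ?_, fun he => ?_, fun he => ?_⟩
  on_goal 1 => have q := quot_bound 1 (by omega) he (by omega) (by omega)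
  on_goal 2 => have q := quot_bound 4 (by omega) he (by omega) (by omega)
  on_goal 3 => have q := quot_bound 5 (by omega) he (by omega) (by omega)
  on_goal 4 => have q := quot_bound 3 (by omega) he (by omega) (by omega)
  all_goals
    obtain ⟨hd1, hd2⟩ := q
    clear b b'
    cases h <;> cases h' <;> first
      | (exfalso; clear he hd1 hd2; omega)
      | (interval_cases d <;> omega)

theorem familyE (n : ℕ) (k : ℤ) (h3 : k % 3 ≠ 0) (h2 : k % 2 = 1) (hp : 1 ≤ k) (hn : 4*k = (n : ℤ)) :
    ∃ S : Set (ZMod n × ZMod n), ConflictFree S ∧ S.ncard = n - 2 :=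
  build n (4*k) (4*k-2) (4*k-1) hn (by omega) (by omega) (by omega) (CellE k)
    (existsE k h3 h2 hp) (sepE k h3 h2 hp)

/-- Cells of family F. -/
inductive CellF (j : ℤ) : ℤ → ℤ → ℤ → Prop
  | p0 (i : ℤ) (h0 : 0 ≤ i) (h1 : i < j-1) : CellF j i (i) (3*i+(0))
  | p1 (i : ℤ) (h0 : j-1 ≤ i) (h1 : i < 2*j-2) : CellF j i (i) (3*i+(3))
  | p2 (i : ℤ) (h0 : 2*j-2 ≤ i) (h1 : i < 3*j-3) : CellF j i (i) (3*i+(6))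
  | p3 (i : ℤ) (h0 : 3*j-3 ≤ i) (h1 : i < 4*j-4) : CellF j i (i) (3*i+(9))
  | p4 (i : ℤ) (h0 : 4*j-3 ≤ i) (h1 : i < 5*j-4) : CellF j i (i) (3*i+(9))
  | p5 (i : ℤ) (h0 : 5*j-4 ≤ i) (h1 : i < 5*j-3) : CellF j i (i) (3*i+(9+4*j))
  | p6 (i : ℤ) (h0 : 5*j-3 ≤ i) (h1 : i < 6*j-4) : CellF j i (i) (3*i+(6))
  | p7 (i : ℤ) (h0 : 6*j-4 ≤ i) (h1 : i < 6*j-3) : CellF j i (i) (3*i+(9-4*j))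
  | p8 (i : ℤ) (h0 : 6*j-2 ≤ i) (h1 : i < 7*j-1) : CellF j i (i) (3*i+(3))
  | p9 (i : ℤ) (h0 : 7*j-1 ≤ i) (h1 : i < 7*j) : CellF j i (i) (3*i+(-4*j))
  | p10 (i : ℤ) (h0 : 7*j ≤ i) (h1 : i < 8*j-1) : CellF j i (i) (3*i+(0))
  | p11 (i : ℤ) (h0 : 8*j-1 ≤ i) (h1 : i < 8*j) : CellF j i (i) (3*i+(-4*j))

theorem boundsF (j : ℤ) (h3 : j % 3 ≠ 0) (hp : 1 ≤ j) {i x y : ℤ} (h : CellF j i x y) :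
    ((8*j) * (0) ≤ x ∧ x < (8*j) * (1)) ∧ ((8*j) * (0) ≤ y ∧ y < (8*j) * (3)) ∧
    ((8*j) * (0) ≤ x + y ∧ x + y < (8*j) * (4)) ∧ ((8*j) * (-2) ≤ x - y ∧ x - y < (8*j) * (1)) := by
  cases h <;> omega

theorem existsF (j : ℤ) (h3 : j % 3 ≠ 0) (hp : 1 ≤ j) (i : ℤ) (hi0 : 0 ≤ i) (hi1 : i < 8*j)
    (hs : i ≠ 4*j-4) (ht : i ≠ 6*j-3) : ∃ x y, CellF j i x y := by
  by_cases c0 : i < j-1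
  · exact ⟨_, _, CellF.p0 i (by omega) c0⟩
  by_cases c1 : i < 2*j-2
  · exact ⟨_, _, CellF.p1 i (by omega) c1⟩
  by_cases c2 : i < 3*j-3
  · exact ⟨_, _, CellF.p2 i (by omega) c2⟩
  by_cases c3 : i < 4*j-4
  · exact ⟨_, _, CellF.p3 i (by omega) c3⟩
  by_cases c4 : i < 5*j-4
  · exact ⟨_, _, CellF.p4 i (by omega) c4⟩
  by_cases c5 : i < 5*j-3
  · exact ⟨_, _, CellF.p5 i (by omega) c5⟩
  by_cases c6 : i < 6*j-4
  · exact ⟨_, _, CellF.p6 i (by omega) c6⟩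
  by_cases c7 : i < 6*j-3
  · exact ⟨_, _, CellF.p7 i (by omega) c7⟩
  by_cases c8 : i < 7*j-1
  · exact ⟨_, _, CellF.p8 i (by omega) c8⟩
  by_cases c9 : i < 7*j
  · exact ⟨_, _, CellF.p9 i (by omega) c9⟩
  by_cases c10 : i < 8*j-1
  · exact ⟨_, _, CellF.p10 i (by omega) c10⟩
  exact ⟨_, _, CellF.p11 i (by omega) (by omega)⟩

set_option maxHeartbeats 4000000 in
theorem sepF (j : ℤ) (h3 : j % 3 ≠ 0) (hp : 1 ≤ j) (i i' x y x' y' d : ℤ) (hlt : i < i')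
    (h : CellF j i x y) (h' : CellF j i' x' y') :
    x - x' ≠ (8*j) * d ∧ y - y' ≠ (8*j) * d ∧ (x + y) - (x' + y') ≠ (8*j) * d ∧
      (x - y) - (x' - y') ≠ (8*j) * d := by
  have b := boundsF j h3 hp h
  have b' := boundsF j h3 hp h'
  refine ⟨fun he => ?_, fun he => ?_, fun he => ?_, fun he => ?_⟩
  on_goal 1 => have q := quot_bound 1 (by omega) he (by omega) (by omega)
  on_goal 2 => have q := quot_bound 3 (by omega) he (by omega) (by omega)
  on_goal 3 => have q := quot_bound 4 (by omega) he (by omega) (by omega)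
  on_goal 4 => have q := quot_bound 3 (by omega) he (by omega) (by omega)
  all_goals
    obtain ⟨hd1, hd2⟩ := q
    clear b b'
    cases h <;> cases h' <;> first
      | (exfalso; clear he hd1 hd2; omega)
      | (interval_cases d <;> omega)

theorem familyF (n : ℕ) (j : ℤ) (h3 : j % 3 ≠ 0) (hp : 1 ≤ j) (hn : 8*j = (n : ℤ)) :
    ∃ S : Set (ZMod n × ZMod n), ConflictFree S ∧ S.ncard = n - 2 :=
  build n (8*j) (4*j-4) (6*j-3) hn (by omega) (by omega) (by omega) (CellF j)
    (existsF j h3 hp) (sepF j h3 hp)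

theorem queens_n_sub_two_always (n : ℕ) (hn : 2 ≤ n) :
    ∃ S : Set (ZMod n × ZMod n), ConflictFree S ∧ S.ncard = n - 2 := by
  by_cases h3 : n % 3 = 0
  · by_cases h2 : n % 2 = 1
    · by_cases hn3 : n = 3
      · subst hn3
        refine ⟨{(0, 0)}, ?_, by simp⟩
        intro p hp q hq hne
        rw [Set.mem_singleton_iff] at hp hq
        exact absurd (hp.trans hq.symm) hne
      · exact familyB n (n / 6 : ℕ) (by omega) (by omega)
    · by_cases h4 : n % 4 = 0
      · exact familyCa n (n / 12 : ℕ) (by omega) (by omega)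
      · exact familyCb n (n / 12 : ℕ) (by omega) (by omega)
  · by_cases h2 : n % 2 = 1
    · exact familyA n n (by omega) (by omega) (by omega) rfl
    · by_cases h4 : n % 4 = 0
      · by_cases h8 : n % 8 = 0
        · exact familyF n (n / 8 : ℕ) (by omega) (by omega) (by omega)
        · exact familyE n (n / 4 : ℕ) (by omega) (by omega) (by omega) (by omega)
      · exact familyD n (n / 4 : ℕ) (by omega) (by omega) (by omega)
end

section
/- Let n be an odd positive integer and let S be a conflict-free set of exactly n − 1 cells in (ZMod n)². Then there exists a cell p ∈ (ZMod n)² with p ∉ S such that S ∪ {p} is still conflict-free (hence conflict-free of size n). -/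
theorem sum_univ_zmod_odd (n : ℕ) [NeZero n] (hodd : Odd n) : ∑ x : ZMod n, x = 0 := by
  have h : ∑ x : ZMod n, x = ∑ x : ZMod n, -x :=
    (Equiv.sum_comp (Equiv.neg (ZMod n)) (fun x => x)).symm
  rw [Finset.sum_neg_distrib] at h
  have h2 : (2 : ZMod n) * ∑ x : ZMod n, x = 0 := by
    rw [two_mul]
    nth_rewrite 1 [h]
    simp
  have hu : IsUnit ((2 : ℕ) : ZMod n) :=
    (ZMod.isUnit_iff_coprime 2 n).2 hodd.coprime_two_left
  exact (hu.mul_right_eq_zero).1 (by exact_mod_cast h2)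

/-- An injective image of `n - 1` cells misses exactly the negated sum. -/
theorem missing_value (n : ℕ) [NeZero n] (hodd : Odd n) {α : Type*} (T : Finset α)
    (hT : T.card = n - 1) (f : α → ZMod n) (hf : Set.InjOn f T) :
    ∀ a ∈ T, f a ≠ -∑ b ∈ T, f b := by
  classical
  have hn : 0 < n := Nat.pos_of_ne_zero (NeZero.ne n)
  have hc : (T.image f)ᶜ.card = 1 := by
    rw [Finset.card_compl, Finset.card_image_of_injOn hf, ZMod.card, hT]
    omega
  obtain ⟨c, hc⟩ := Finset.card_eq_one.1 hc
  have hsum := Finset.sum_add_sum_compl (T.image f) (fun x => x)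
  rw [hc, Finset.sum_singleton, sum_univ_zmod_odd n hodd, Finset.sum_image hf] at hsum
  have hcv : c = -∑ b ∈ T, f b := (neg_eq_of_add_eq_zero_right hsum).symm
  have hmem : c ∈ (T.image f)ᶜ := by rw [hc]; simp
  intro a ha h
  rw [← hcv] at h
  exact Finset.mem_compl.1 hmem (h ▸ Finset.mem_image_of_mem f ha)

theorem queens_odd_extend (n : ℕ) (hn : 0 < n) (hodd : Odd n)
    (S : Set (ZMod n × ZMod n)) (hS : ConflictFree S) (hcard : S.ncard = n - 1) :
    ∃ p : ZMod n × ZMod n, p ∉ S ∧ ConflictFree (insert p S) := by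
  classical
  haveI : NeZero n := ⟨hn.ne'⟩
  obtain ⟨T, rfl⟩ : ∃ T : Finset (ZMod n × ZMod n), (T : Set _) = S :=
    ⟨S.toFinite.toFinset, by simp⟩
  rw [Set.ncard_coe_finset] at hcard
  have key : ∀ f : ZMod n × ZMod n → ZMod n, (∀ p q, f p = f q → Conflict p q) →
      ∀ a ∈ T, f a ≠ -∑ b ∈ T, f b := fun f hf =>
    missing_value n hodd T hcard f fun p hp q hq h => by
      by_contra hne
      exact hS p hp q hq hne (hf p q h)
  have h1 := key (fun p => p.1) fun p q h => Or.inl h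
  have h2 := key (fun p => p.2) fun p q h => Or.inr (Or.inl h)
  have h3 := key (fun p => p.1 + p.2) fun p q h => Or.inr (Or.inr (Or.inl h))
  have h4 := key (fun p => p.1 - p.2) fun p q h => Or.inr (Or.inr (Or.inr h))
  simp only [Finset.sum_add_distrib, Finset.sum_sub_distrib] at h3 h4
  generalize ∑ b ∈ T, b.1 = A at *
  generalize ∑ b ∈ T, b.2 = B at *
  have hno : ∀ q ∈ T, ¬ Conflict q (-A, -B) := by
    rintro q hq (h | h | h | h)
    · exact h1 q hq h
    · exact h2 q hq h
    · exact h3 q hq (h.trans (by ring))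
    · exact h4 q hq (h.trans (by ring))
  have hsymm : ∀ p q : ZMod n × ZMod n, Conflict p q → Conflict q p := by
    rintro p q (h | h | h | h)
    · exact Or.inl h.symm
    · exact Or.inr (Or.inl h.symm)
    · exact Or.inr (Or.inr (Or.inl h.symm))
    · exact Or.inr (Or.inr (Or.inr h.symm))
  refine ⟨(-A, -B), fun h => h1 _ h rfl, ?_⟩
  rintro p (rfl | hp) q (rfl | hq) hne
  · exact absurd rfl hne
  · exact fun h => hno q hq (hsymm _ _ h)
  · exact hno p hp
  · exact hS p hp q hq hne
end

section
/- For all integers n ≥ 1 and d ≥ 1, every conflict-free set of cells in (ZMod n)^d has at most n^(d−1) elements. -/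
/-- Two cells `p q` of the toroidal board `(ZMod n)^d` are in conflict as toroidal queens
if `q - p` is a scalar multiple `t • ε` of some nonzero direction vector `ε` all of whose
entries are images in `ZMod n` of `-1`, `0` or `1`. -/
def ConflictD {n d : ℕ} (p q : Fin d → ZMod n) : Prop :=
  ∃ ε : Fin d → ZMod n,
    (∀ i, ε i = -1 ∨ ε i = 0 ∨ ε i = 1) ∧ ε ≠ 0 ∧
    ∃ t : ZMod n, ∀ i, q i - p i = t * ε i

/-- A set of cells is conflict-free if no two distinct cells of it are in conflict. -/
def ConflictFreeD {n d : ℕ} (S : Set (Fin d → ZMod n)) : Prop :=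
  ∀ p ∈ S, ∀ q ∈ S, p ≠ q → ¬ ConflictD p q

theorem queens_upper_bound (n d : ℕ) (hn : 1 ≤ n) (hd : 1 ≤ d)
    (S : Set (Fin d → ZMod n)) (hS : ConflictFreeD S) :
    S.ncard ≤ n ^ (d - 1) := by
  obtain ⟨k, rfl⟩ : ∃ k, d = k + 1 := ⟨d - 1, by omega⟩
  haveI : NeZero n := ⟨by omega⟩
  have inj : Set.InjOn (fun (p : Fin (k + 1) → ZMod n) (i : Fin k) => p i.succ) S := by
    intro p hp q hq hpq
    by_contra hne
    apply hS p hp q hq hne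
    refine ⟨Pi.single 0 1, ?_, ?_, q 0 - p 0, ?_⟩
    · intro i
      by_cases h : i = 0
      · subst h; simp
      · simp [h]
    · intro h0
      have h1 : (1 : ZMod n) = 0 := by simpa using congrFun h0 0
      apply hne
      funext i
      rw [← mul_one (p i), ← mul_one (q i), h1, mul_zero, mul_zero]
    · intro i
      refine Fin.cases ?_ (fun j => ?_) i
      · simp
      · have := congrFun hpq j
        simp only at this
        simp [this]
  have h := Set.ncard_le_ncard_of_injOn (t := Set.univ) _ (fun _ _ => Set.mem_univ _) inj
    Set.finite_univ
  simpa [Set.ncard_univ, Nat.card_eq_fintype_card, ZMod.card] using h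
end

section
/- Let d ≥ 2 and let n be a positive integer having no prime divisor less than 2^d. Then there exists a conflict-free set of exactly n^(d−1) cells in (ZMod n)^d. -/
/-- Signed binary digit sums are bounded by `2 ^ d` and vanish only for the zero digits. -/
lemma signed_binary (d : ℕ) : ∀ e : Fin d → ℤ, (∀ i, e i = -1 ∨ e i = 0 ∨ e i = 1) →
    |∑ i : Fin d, 2 ^ (i : ℕ) * e i| < 2 ^ d ∧ (∑ i : Fin d, 2 ^ (i : ℕ) * e i = 0 → ∀ i, e i = 0) := by
  induction d with
  | zero => intro e _; simp
  | succ d ih =>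
    intro e he
    obtain ⟨h1, h2⟩ := ih (fun i => e i.succ) (fun i => he _)
    have hs : ∑ i : Fin (d + 1), 2 ^ (i : ℕ) * e i = e 0 + 2 * ∑ i : Fin d, 2 ^ (i : ℕ) * e i.succ := by
      rw [Fin.sum_univ_succ, Finset.mul_sum]
      congr 1
      · simp
      · refine Finset.sum_congr rfl fun i _ => ?_
        rw [Fin.val_succ]; ring
    rw [hs]
    generalize (∑ i : Fin d, 2 ^ (i : ℕ) * e i.succ) = s at h1 h2 ⊢
    have h0 := he 0
    rw [abs_lt] at h1 ⊢
    have hpow : (2 : ℤ) ^ (d + 1) = 2 * 2 ^ d := by ring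
    rw [hpow]
    generalize (2 : ℤ) ^ d = P at *
    refine ⟨by omega, fun h => ?_⟩
    have hs0 : s = 0 := by omega
    have he0 : e 0 = 0 := by omega
    intro i
    refine Fin.cases he0 (fun j => h2 hs0 j) i

theorem queens_full_construction_exists (n d : ℕ) (hn : 0 < n) (hd : 2 ≤ d)
    (hp : ∀ p : ℕ, p.Prime → p ∣ n → 2 ^ d ≤ p) :
    ∃ S : Set (Fin d → ZMod n), ConflictFreeD S ∧ S.ncard = n ^ (d - 1) := by
  refine ⟨{x | ∑ i : Fin d, 2 ^ (i : ℕ) * x i = 0}, ?_, ?_⟩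
  · rintro p hpS q hqS hpq ⟨ε, hε, hε0, t, ht⟩
    apply hpq
    have hex : ∀ i, ∃ z : ℤ, (z = -1 ∨ z = 0 ∨ z = 1) ∧ (z : ZMod n) = ε i := by
      intro i
      rcases hε i with h | h | h
      · exact ⟨-1, by simp, by simp [h]⟩
      · exact ⟨0, by simp, by simp [h]⟩
      · exact ⟨1, by simp, by simp [h]⟩
    choose e he1 he2 using hex
    obtain ⟨hb, hz⟩ := signed_binary d e he1
    have hsum : t * ((∑ i : Fin d, 2 ^ (i : ℕ) * e i : ℤ) : ZMod n) = 0 := by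
      have h : ∑ i : Fin d, 2 ^ (i : ℕ) * (q i - p i) = 0 := by
        simp only [mul_sub, Finset.sum_sub_distrib]
        rw [Set.mem_ofPred_eq] at hpS hqS
        rw [hpS, hqS, sub_zero]
      rw [← h]
      push_cast
      rw [Finset.mul_sum]
      refine Finset.sum_congr rfl fun i _ => ?_
      rw [ht i, he2 i]; ring
    have hne : ∑ i : Fin d, 2 ^ (i : ℕ) * e i ≠ 0 := by
      intro h
      apply hε0
      funext i
      rw [← he2 i, hz h i]; simp
    generalize (∑ i : Fin d, 2 ^ (i : ℕ) * e i) = s at *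
    have hcop : IsCoprime s (n : ℤ) := by
      rw [Int.isCoprime_iff_gcd_eq_one]
      by_contra hg
      obtain ⟨r, hr, hrg⟩ := Nat.exists_prime_and_dvd hg
      have h1 : r ∣ s.natAbs := hrg.trans (Nat.gcd_dvd_left _ _)
      have h2 : r ∣ n := hrg.trans (Nat.gcd_dvd_right _ _)
      have h3 := hp r hr h2
      have h4 := Nat.le_of_dvd (Int.natAbs_pos.mpr hne) h1
      rw [Int.abs_eq_natAbs] at hb
      have h5 : s.natAbs < 2 ^ d := by exact_mod_cast hb
      omega
    have ht0 : t = 0 := by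
      obtain ⟨a, b, hab⟩ := hcop
      have h := congrArg (Int.cast : ℤ → ZMod n) hab
      push_cast at h
      rw [ZMod.natCast_self, mul_zero, add_zero] at h
      calc t = t * ((a : ZMod n) * s) := by rw [h, mul_one]
        _ = a * (t * s) := by ring
        _ = 0 := by rw [hsum, mul_zero]
    funext i
    have h := ht i
    rw [ht0, zero_mul, sub_eq_zero] at h
    exact h.symm
  · obtain ⟨m, rfl⟩ : ∃ m, d = m + 1 := ⟨d - 1, by omega⟩
    have : NeZero n := ⟨hn.ne'⟩
    let f : (Fin m → ZMod n) → (Fin (m + 1) → ZMod n) := fun x =>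
      Fin.cons (-∑ i : Fin m, 2 ^ ((i : ℕ) + 1) * x i) x
    have hf : Function.Injective f := fun x y h => (Fin.cons_inj.mp h).2
    have hS : {x : Fin (m + 1) → ZMod n | ∑ i : Fin (m + 1), 2 ^ (i : ℕ) * x i = 0} = f '' Set.univ := by
      ext x
      simp only [Set.mem_ofPred_eq, Set.image_univ, Set.mem_range, f]
      rw [Fin.sum_univ_succ]
      simp only [Fin.val_succ, Fin.val_zero, pow_zero, one_mul]
      constructor
      · intro h
        refine ⟨fun i => x i.succ, ?_⟩
        funext i
        refine Fin.cases ?_ (fun j => ?_) i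
        · rw [Fin.cons_zero]; exact (eq_neg_of_add_eq_zero_left h).symm
        · rw [Fin.cons_succ]
      · rintro ⟨y, rfl⟩
        simp
    rw [hS, Set.ncard_image_of_injective _ hf, Set.ncard_univ]
    simp [Nat.card_eq_fintype_card, ZMod.card]
end

section
/- Let n be a positive integer coprime to 6 that is divisible by 5 but not by 25. Then there is no conflict-free set of n² cells in (ZMod n)³. -/
/-- Two cells `p q` of the toroidal board `(ZMod n)³` are in conflict as toroidal queens
if `q - p` is a scalar multiple `t • ε` (componentwise) of some nonzero direction vector
`ε` all of whose entries are images in `ZMod n` of `-1`, `0` or `1`. -/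
def Conflict3 {n : ℕ} (p q : ZMod n × ZMod n × ZMod n) : Prop :=
  ∃ ε : ZMod n × ZMod n × ZMod n,
    (ε.1 = -1 ∨ ε.1 = 0 ∨ ε.1 = 1) ∧
    (ε.2.1 = -1 ∨ ε.2.1 = 0 ∨ ε.2.1 = 1) ∧
    (ε.2.2 = -1 ∨ ε.2.2 = 0 ∨ ε.2.2 = 1) ∧
    ε ≠ 0 ∧
    ∃ t : ZMod n, q.1 - p.1 = t * ε.1 ∧ q.2.1 - p.2.1 = t * ε.2.1 ∧
      q.2.2 - p.2.2 = t * ε.2.2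

/-- A set of cells is conflict-free if no two distinct cells of it are in conflict. -/
def ConflictFree3 {n : ℕ} (S : Set (ZMod n × ZMod n × ZMod n)) : Prop :=
  ∀ p ∈ S, ∀ q ∈ S, p ≠ q → ¬ Conflict3 p q

theorem exists_dir5 : ∀ a b c : ZMod 5,
    ∃ x ∈ ({-1, 0, 1} : Finset ℤ), ∃ y ∈ ({-1, 0, 1} : Finset ℤ),
      ∃ z ∈ ({-1, 0, 1} : Finset ℤ), (x = 1 ∨ y = 1 ∨ z = 1) ∧
        a * (x : ZMod 5) + b * (y : ZMod 5) + c * (z : ZMod 5) = 0 := by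
  decide

/-- The homomorphism `s ↦ a s₁ + b s₂ + c s₃` to `ZMod 5`. -/
def lin5 {n : ℕ} (h5 : 5 ∣ n) (a b c : ZMod 5) : ZMod n × ZMod n × ZMod n →+ ZMod 5 where
  toFun s := a * ZMod.castHom h5 (ZMod 5) s.1 + b * ZMod.castHom h5 (ZMod 5) s.2.1
    + c * ZMod.castHom h5 (ZMod 5) s.2.2
  map_zero' := by simp
  map_add' s t := by
    simp only [Prod.fst_add, Prod.snd_add, map_add]
    ring

theorem lin5_apply {n : ℕ} (h5 : 5 ∣ n) (a b c : ZMod 5) (s : ZMod n × ZMod n × ZMod n) :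
    lin5 h5 a b c s = a * ZMod.castHom h5 (ZMod 5) s.1 + b * ZMod.castHom h5 (ZMod 5) s.2.1
    + c * ZMod.castHom h5 (ZMod 5) s.2.2 := rfl

theorem stdAddChar5_eq_one {x : ZMod 5} (h : ZMod.stdAddChar x = 1) : x = 0 := by
  apply ZMod.injective_stdAddChar
  rw [h, AddChar.map_zero_eq_one]

/-- The full character sum over the board vanishes. -/
theorem board_sum {n : ℕ} [NeZero n] (h5 : 5 ∣ n) (a b c : ZMod 5)
    (h : ¬ (a = 0 ∧ b = 0 ∧ c = 0)) :
    ∑ s : ZMod n × ZMod n × ZMod n, ZMod.stdAddChar (lin5 h5 a b c s) = (0 : ℂ) := by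
  have key : ((ZMod.stdAddChar (N := 5)).compAddMonoidHom (lin5 h5 a b c)) ≠ 0 := by
    intro h0
    apply h
    have e : ∀ s, ZMod.stdAddChar (lin5 h5 a b c s) = 1 := fun s => by
      simpa using DFunLike.congr_fun h0 s
    refine ⟨?_, ?_, ?_⟩
    · simpa only [lin5_apply, map_one, map_zero, mul_one, mul_zero, add_zero, zero_add] using stdAddChar5_eq_one (e (1, 0, 0))
    · simpa only [lin5_apply, map_one, map_zero, mul_one, mul_zero, add_zero, zero_add] using stdAddChar5_eq_one (e (0, 1, 0))
    · simpa only [lin5_apply, map_one, map_zero, mul_one, mul_zero, add_zero, zero_add] using stdAddChar5_eq_one (e (0, 0, 1))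
  simpa using AddChar.sum_eq_zero_iff_ne_zero.2 key

/-- Character sums over a full conflict-free set vanish. -/
theorem queens_sum {n : ℕ} [NeZero n] (h5 : 5 ∣ n) (S : Finset (ZMod n × ZMod n × ZMod n))
    (hS : ConflictFree3 (S : Set (ZMod n × ZMod n × ZMod n))) (hc : S.card = n ^ 2)
    (a b c : ZMod 5) (h : ¬ (a = 0 ∧ b = 0 ∧ c = 0)) :
    ∑ s ∈ S, ZMod.stdAddChar (lin5 h5 a b c s) = (0 : ℂ) := by
  have hn5 : 5 ≤ n := Nat.le_of_dvd (Nat.pos_of_ne_zero (NeZero.ne n)) h5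
  haveI : Fact (1 < n) := ⟨by omega⟩
  obtain ⟨x, hx, y, hy, z, hz, hu, h0⟩ := exists_dir5 a b c
  have mem : ∀ w ∈ ({-1, 0, 1} : Finset ℤ), (w : ZMod n) = -1 ∨ (w : ZMod n) = 0 ∨
      (w : ZMod n) = 1 := by
    intro w hw
    simp only [Finset.mem_insert, Finset.mem_singleton] at hw
    rcases hw with rfl | rfl | rfl <;> simp
  let ε : ZMod n × ZMod n × ZMod n := (x, y, z)
  have hε : ε ≠ 0 := by
    intro he
    simp only [ε, Prod.ext_iff, Prod.fst_zero, Prod.snd_zero] at he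
    rcases hu with rfl | rfl | rfl <;> simp at he
  let g : S × ZMod n → ZMod n × ZMod n × ZMod n :=
    fun p => p.1.1 + (p.2 * x, p.2 * y, p.2 * z)
  have ginj : Function.Injective g := by
    rintro ⟨⟨s, hs⟩, t⟩ ⟨⟨s', hs'⟩, t'⟩ hg
    simp only [g, Prod.ext_iff, Prod.fst_add, Prod.snd_add] at hg
    obtain ⟨g1, g2, g3⟩ := hg
    have hss : s = s' := by
      by_contra hne
      exact hS s hs s' hs' hne ⟨ε, mem x hx, mem y hy, mem z hz, hε, t - t',
        by simp only [ε]; linear_combination -g1, by simp only [ε]; linear_combination -g2,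
        by simp only [ε]; linear_combination -g3⟩
    subst hss
    have htt : t = t' := by
      rcases hu with rfl | rfl | rfl
      · simpa using g1
      · simpa using g2
      · simpa using g3
    subst htt
    rfl
  have gbij : Function.Bijective g := by
    rw [Fintype.bijective_iff_injective_and_card]
    refine ⟨ginj, ?_⟩
    simp only [Fintype.card_prod, Fintype.card_coe, ZMod.card, hc]
    ring
  have hsum := board_sum h5 a b c h
  rw [← gbij.sum_comp (fun s => ZMod.stdAddChar (lin5 h5 a b c s)), Fintype.sum_prod_type] at hsum
  have hg : ∀ (s : S) (t : ZMod n), lin5 h5 a b c (g (s, t)) = lin5 h5 a b c s.1 := by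
    intro s t
    simp only [g, map_add]
    simp only [lin5_apply, map_mul, map_intCast]
    linear_combination (ZMod.castHom h5 (ZMod 5) t) * h0
  simp only [hg, Finset.sum_const, Finset.card_univ, ZMod.card] at hsum
  rw [← Finset.smul_sum, Finset.sum_coe_sort S
    (fun s => (ZMod.stdAddChar (lin5 h5 a b c s) : ℂ))] at hsum
  simpa [NeZero.ne n] using hsum

theorem dual_sum (u : ZMod 5) :
    ∑ a : ZMod 5, ZMod.stdAddChar (a * u) = if u = 0 then (5 : ℂ) else 0 := by
  simpa using AddChar.sum_mulShift u (ZMod.isPrimitive_stdAddChar 5)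

theorem dual_sum3 {n : ℕ} (h5 : 5 ∣ n) (s : ZMod n × ZMod n × ZMod n) :
    ∃ k : ℤ, ∑ a : ZMod 5, ∑ b : ZMod 5, ∑ c : ZMod 5,
      ZMod.stdAddChar (lin5 h5 a b c s) = (125 : ℂ) * k := by
  simp only [lin5_apply, AddChar.map_add_eq_mul, ← Finset.mul_sum, ← Finset.sum_mul, dual_sum]
  split_ifs
  all_goals first
    | (refine ⟨1, ?_⟩; norm_num; done)
    | (refine ⟨0, ?_⟩; norm_num; done)

theorem no_full_queens_dim_three (n : ℕ) (hn : 0 < n) (h6 : Nat.Coprime n 6)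
    (h5 : 5 ∣ n) (h25 : ¬ (25 ∣ n)) :
    ¬ ∃ S : Set (ZMod n × ZMod n × ZMod n), ConflictFree3 S ∧ S.ncard = n ^ 2 := by
  rintro ⟨S, hS, hc⟩
  haveI : NeZero n := ⟨hn.ne'⟩
  obtain ⟨T, rfl⟩ : ∃ T : Finset (ZMod n × ZMod n × ZMod n), (T : Set _) = S :=
    ⟨S.toFinite.toFinset, by simp⟩
  rw [Set.ncard_coe_finset] at hc
  choose k hk using dual_sum3 (n := n) h5
  have h1 : ∑ s ∈ T, ∑ a : ZMod 5, ∑ b : ZMod 5, ∑ c : ZMod 5,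
      ZMod.stdAddChar (lin5 h5 a b c s) = (125 : ℂ) * ((∑ s ∈ T, k s : ℤ) : ℂ) := by
    simp only [hk, ← Finset.mul_sum, Int.cast_sum]
  have h2 : ∑ s ∈ T, ∑ p : ZMod 5 × ZMod 5 × ZMod 5,
      (ZMod.stdAddChar (lin5 h5 p.1 p.2.1 p.2.2 s) : ℂ) = (n : ℂ) ^ 2 := by
    rw [Finset.sum_comm, Finset.sum_eq_single (0 : ZMod 5 × ZMod 5 × ZMod 5)]
    · simp [lin5_apply, hc]
    · rintro ⟨a, b, c⟩ - hne
      exact queens_sum h5 T hS hc a b c fun h => hne (by simp [h.1, h.2.1, h.2.2])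
    · simp
  simp only [Fintype.sum_prod_type] at h2
  rw [h1] at h2
  have h3 : (125 : ℤ) * (∑ s ∈ T, k s) = (n : ℤ) ^ 2 := by exact_mod_cast h2
  obtain ⟨m, rfl⟩ := h5
  have h4 : (5 : ℤ) ∣ (m : ℤ) ^ 2 := ⟨∑ s ∈ T, k s, by push_cast at h3; linarith⟩
  have h7 : (5 : ℤ) ∣ (m : ℤ) := Int.Prime.dvd_pow' (by norm_num) h4
  have h8 : 5 ∣ m := by exact_mod_cast h7
  exact h25 (by omega)
end

section
/- Let n be a positive integer and let S be a conflict-free set of exactly n² cells in (ZMod n)³. Then each of the following seven maps from (ZMod n)³ to (ZMod n)², when restricted to S, is a bijection from S onto (ZMod n)²: (x,y,z) ↦ (y,z); (x,y,z) ↦ (x+y,z); (x,y,z) ↦ (x−y,z); (x,y,z) ↦ (x+y,x+z); (x,y,z) ↦ (x+y,x−z); (x,y,z) ↦ (x−y,x+z); (x,y,z) ↦ (x−y,x−z). -/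
theorem queens_aux (n : ℕ) (hn : 0 < n)
    (S : Set (ZMod n × ZMod n × ZMod n)) (hS : ConflictFree3 S)
    (hcard : S.ncard = n ^ 2)
    (f : ZMod n × ZMod n × ZMod n → ZMod n × ZMod n) (b c : ZMod n)
    (hb : b = -1 ∨ b = 0 ∨ b = 1) (hc : c = -1 ∨ c = 0 ∨ c = 1)
    (hf : ∀ p q, f p = f q →
      q.2.1 - p.2.1 = (q.1 - p.1) * b ∧ q.2.2 - p.2.2 = (q.1 - p.1) * c) :
    Set.BijOn f S Set.univ := by
  haveI : NeZero n := ⟨hn.ne'⟩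
  have hinj : Set.InjOn f S := by
    intro p hp q hq hpq
    by_contra hne
    refine hS p hp q hq hne ⟨(1, b, c), Or.inr (Or.inr rfl), hb, hc, ?_, q.1 - p.1, by simp,
      (hf p q hpq).1, (hf p q hpq).2⟩
    intro h0
    have h1 : (1 : ZMod n) = 0 := congrArg Prod.fst h0
    haveI : Subsingleton (ZMod n) := subsingleton_of_zero_eq_one h1.symm
    exact hne (Subsingleton.elim p q)
  have himg : f '' S = Set.univ := by
    apply Set.eq_of_subset_of_ncard_le (Set.subset_univ _)
    rw [Set.ncard_image_of_injOn hinj, hcard, Set.ncard_univ, Nat.card_prod, Nat.card_zmod, sq]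
  exact ⟨Set.mapsTo_univ _ _, hinj, himg.ge⟩

theorem queens_projections_bijective (n : ℕ) (hn : 0 < n)
    (S : Set (ZMod n × ZMod n × ZMod n)) (hS : ConflictFree3 S)
    (hcard : S.ncard = n ^ 2) :
    Set.BijOn (fun p : ZMod n × ZMod n × ZMod n => (p.2.1, p.2.2)) S Set.univ ∧
    Set.BijOn (fun p : ZMod n × ZMod n × ZMod n => (p.1 + p.2.1, p.2.2)) S Set.univ ∧
    Set.BijOn (fun p : ZMod n × ZMod n × ZMod n => (p.1 - p.2.1, p.2.2)) S Set.univ ∧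
    Set.BijOn (fun p : ZMod n × ZMod n × ZMod n => (p.1 + p.2.1, p.1 + p.2.2)) S Set.univ ∧
    Set.BijOn (fun p : ZMod n × ZMod n × ZMod n => (p.1 + p.2.1, p.1 - p.2.2)) S Set.univ ∧
    Set.BijOn (fun p : ZMod n × ZMod n × ZMod n => (p.1 - p.2.1, p.1 + p.2.2)) S Set.univ ∧
    Set.BijOn (fun p : ZMod n × ZMod n × ZMod n => (p.1 - p.2.1, p.1 - p.2.2)) S Set.univ := by
  refine ⟨queens_aux n hn S hS hcard _ (0) (0) (by simp) (by simp) ?_,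
    queens_aux n hn S hS hcard _ (-1) (0) (by simp) (by simp) ?_,
    queens_aux n hn S hS hcard _ (1) (0) (by simp) (by simp) ?_,
    queens_aux n hn S hS hcard _ (-1) (-1) (by simp) (by simp) ?_,
    queens_aux n hn S hS hcard _ (-1) (1) (by simp) (by simp) ?_,
    queens_aux n hn S hS hcard _ (1) (-1) (by simp) (by simp) ?_,
    queens_aux n hn S hS hcard _ (1) (1) (by simp) (by simp) ?_⟩ <;>
  · intro p q h
    obtain ⟨h1, h2⟩ := Prod.mk.inj h
    constructor <;> grind
end

section
/- Let n be a positive integer coprime to 6. Then n divides the power sums ∑_{x=0}^{n−1} x^p for p = 1, 2, 3. If moreover n is divisible by 5 but not by 25, then n does not divide ∑_{x=0}^{n−1} x⁴ (indeed n/5 divides this sum but n does not). -/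
theorem ps_formulas (n : ℕ) :
    (2 * ((∑ x ∈ Finset.range n, x ^ 1 : ℕ) : ℤ) = n * (n - 1)) ∧
    (6 * ((∑ x ∈ Finset.range n, x ^ 2 : ℕ) : ℤ) = n * ((n - 1) * (2 * n - 1))) ∧
    (4 * ((∑ x ∈ Finset.range n, x ^ 3 : ℕ) : ℤ) = n * (n * (n - 1) ^ 2)) ∧
    (30 * ((∑ x ∈ Finset.range n, x ^ 4 : ℕ) : ℤ)
      = n * (6 * n ^ 4 - 15 * n ^ 3 + 10 * n ^ 2 - 1)) := by
  induction n with
  | zero => simp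
  | succ k ih =>
    obtain ⟨h1, h2, h3, h4⟩ := ih
    simp only [Finset.sum_range_succ]
    push_cast at *
    refine ⟨?_, ?_, ?_, ?_⟩
    · linear_combination h1
    · linear_combination h2
    · linear_combination h3
    · linear_combination h4

theorem ps_dvd (m S c : ℕ) (t : ℤ) (hc : Nat.Coprime m c) (h : (c : ℤ) * S = m * t) :
    m ∣ S := by
  have h1 : (m : ℤ) ∣ ((c * S : ℕ) : ℤ) := ⟨t, by push_cast; exact h⟩
  exact hc.dvd_of_dvd_mul_left (Int.natCast_dvd_natCast.mp h1)

theorem power_sums_mod_n (n : ℕ) (hn : 0 < n) (h6 : Nat.Coprime n 6) :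
    (n ∣ ∑ x ∈ Finset.range n, x ^ 1) ∧
    (n ∣ ∑ x ∈ Finset.range n, x ^ 2) ∧
    (n ∣ ∑ x ∈ Finset.range n, x ^ 3) ∧
    (5 ∣ n → ¬ (25 ∣ n) →
      (n / 5 ∣ ∑ x ∈ Finset.range n, x ^ 4) ∧ ¬ (n ∣ ∑ x ∈ Finset.range n, x ^ 4)) := by
  obtain ⟨h1, h2, h3, h4⟩ := ps_formulas n
  have hc2 : Nat.Coprime n 2 := h6.coprime_dvd_right (by norm_num)
  have hc4 : Nat.Coprime n 4 := Nat.Coprime.pow_right 2 hc2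
  refine ⟨ps_dvd n _ 2 _ hc2 h1, ps_dvd n _ 6 _ h6 h2, ps_dvd n _ 4 _ hc4 h3, ?_⟩
  rintro ⟨m, rfl⟩ -
  generalize (∑ x ∈ Finset.range (5 * m), x ^ 4) = S at h4
  have hm : 5 * m / 5 = m := by omega
  rw [hm]
  refine ⟨?_, ?_⟩
  · refine ps_dvd m S 6 (hc := h6.coprime_dvd_left (Dvd.intro_left 5 rfl)) (t :=
      6 * (5 * m : ℤ) ^ 4 - 15 * (5 * m : ℤ) ^ 3 + 10 * (5 * m : ℤ) ^ 2 - 1) (h := ?_)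
    push_cast at *
    linarith
  · rintro ⟨k, rfl⟩
    have hz : (m : ℤ) ≠ 0 := by
      have : m ≠ 0 := by omega
      exact_mod_cast this
    push_cast at h4
    have h5 : (30 * k : ℤ) = 6 * (5 * m : ℤ) ^ 4 - 15 * (5 * m : ℤ) ^ 3
        + 10 * (5 * m : ℤ) ^ 2 - 1 := by
      apply mul_left_cancel₀ (mul_ne_zero (by norm_num : (5 : ℤ) ≠ 0) hz)
      linarith
    ring_nf at h5
    omega
end
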